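/- arXiv:2504.01630 — 2 statements merged into one kernel-verified Lean document; each statement's English description precedes it below -/
import Mathlib

section
/- Let d ∈ ℕ, let Θ ⊂ ℝ^d be a nonempty orientable C^1-hypersurface of positive reach, let 𝔫 : Θ → ℝ^d be a normal vector along Θ, and assume that μ : ℝ^d → ℝ^d is intrinsic Lipschitz continuous on ℝ^d \ Θ. Then for every x ∈ Θ and every sign s ∈ {+1, −1}, the limit lim_{h↓0} μ(x + s·h·𝔫(x)) exists in ℝ^d. -/
open Set Metric Filter MeasureTheory
open scoped ENNReal NNReal RealInnerProductSpace ContDiff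

noncomputable section

/-- The hyperplane `ℝ^{d-1} × {0}` inside `ℝ^d` (equal to `{0}` when `d = 1`). -/
def hyperplane (d : ℕ) : Set (EuclideanSpace ℝ (Fin d)) :=
  {y | ∀ i : Fin d, (i : ℕ) = d - 1 → y i = 0}

/-- `M ⊆ ℝ^d` is a `C^k`-hypersurface: every point of `M` admits a `C^k`-chart
flattening `M` onto the hyperplane `ℝ^{d-1} × {0}`. -/
def IsCkHypersurface {d : ℕ} (k : ℕ∞) (M : Set (EuclideanSpace ℝ (Fin d))) : Prop :=
  ∀ x ∈ M, ∃ U V : Set (EuclideanSpace ℝ (Fin d)),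
    ∃ φ ψ : EuclideanSpace ℝ (Fin d) → EuclideanSpace ℝ (Fin d),
      IsOpen U ∧ IsOpen V ∧ x ∈ U ∧
      ContDiffOn ℝ k φ U ∧ ContDiffOn ℝ k ψ V ∧
      Set.MapsTo φ U V ∧ Set.MapsTo ψ V U ∧
      (∀ y ∈ U, ψ (φ y) = y) ∧ (∀ y ∈ V, φ (ψ y) = y) ∧
      φ '' (M ∩ U) = hyperplane d ∩ V

/-- `v` is a tangent vector to `M` at `x`: there is a `C^1`-curve in `M` through `x`
with velocity `v`. -/
def IsTangentVector {d : ℕ} (M : Set (EuclideanSpace ℝ (Fin d)))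
    (x v : EuclideanSpace ℝ (Fin d)) : Prop :=
  ∃ ε : ℝ, 0 < ε ∧ ∃ γ : ℝ → EuclideanSpace ℝ (Fin d),
    (∀ t ∈ Set.Ioo (-ε) ε, γ t ∈ M) ∧ ContDiffOn ℝ 1 γ (Set.Ioo (-ε) ε) ∧
    γ 0 = x ∧ HasDerivAt γ v 0

/-- `n` is a (unit) normal vector field along `M`. -/
def IsNormalVector {d : ℕ} (M : Set (EuclideanSpace ℝ (Fin d)))
    (n : EuclideanSpace ℝ (Fin d) → EuclideanSpace ℝ (Fin d)) : Prop :=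
  ContinuousOn n M ∧ (∀ x ∈ M, ‖n x‖ = 1) ∧
    ∀ x ∈ M, ∀ v, IsTangentVector M x v → ⟪n x, v⟫ = 0

/-- The set of points having a unique nearest point in `M`. -/
def unp {d : ℕ} (M : Set (EuclideanSpace ℝ (Fin d))) : Set (EuclideanSpace ℝ (Fin d)) :=
  {x | ∃! p, p ∈ M ∧ dist x p = Metric.infDist x M}

/-- `p` is a nearest point to `x` in `M`. -/
def IsNearestPt {d : ℕ} (M : Set (EuclideanSpace ℝ (Fin d)))
    (x p : EuclideanSpace ℝ (Fin d)) : Prop :=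
  p ∈ M ∧ dist x p = Metric.infDist x M

/-- The reach of `M`, as an extended nonnegative real:
`reach M = sup {ε ≥ 0 | M^ε ⊆ unp M}` where `M^ε` is the open `ε`-neighbourhood. -/
def reach {d : ℕ} (M : Set (EuclideanSpace ℝ (Fin d))) : ℝ≥0∞ :=
  sSup {r : ℝ≥0∞ | ∃ ε : ℝ, 0 ≤ ε ∧ r = ENNReal.ofReal ε ∧
    {x | Metric.infDist x M < ε} ⊆ unp M}

/-- The intrinsic (geodesic) metric of `A`: the infimum of lengths of continuous
curves in `A` joining `x` to `y` (`∞` if there is none). -/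
def intrinsicDist {d : ℕ} (A : Set (EuclideanSpace ℝ (Fin d)))
    (x y : EuclideanSpace ℝ (Fin d)) : ℝ≥0∞ :=
  ⨅ (γ : ℝ → EuclideanSpace ℝ (Fin d)) (_ : ContinuousOn γ (Set.Icc 0 1))
    (_ : Set.MapsTo γ (Set.Icc 0 1) A) (_ : γ 0 = x) (_ : γ 1 = y),
    eVariationOn γ (Set.Icc 0 1)

/-- `f` is intrinsic Lipschitz continuous on `A` with intrinsic Lipschitz constant `L`. -/
def IntrinsicLipschitzWith {d : ℕ} {F : Type*} [PseudoEMetricSpace F] (L : ℝ≥0)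
    (A : Set (EuclideanSpace ℝ (Fin d))) (f : EuclideanSpace ℝ (Fin d) → F) : Prop :=
  ∀ x ∈ A, ∀ y ∈ A, edist (f x) (f y) ≤ (L : ℝ≥0∞) * intrinsicDist A x y

end
/-- If a ray from `x ∈ M` in direction `v` meets the `C^1`-hypersurface `M` at parameters
accumulating at `0`, then `v` is tangent to `M` at `x`. -/
lemma isTangentVector_of_frequently_mem {d : ℕ} {M : Set (EuclideanSpace ℝ (Fin d))}
    (hM : IsCkHypersurface 1 M) {x v : EuclideanSpace ℝ (Fin d)} (hx : x ∈ M)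
    (hv : ∃ᶠ h : ℝ in nhdsWithin 0 (Ioi 0), x + h • v ∈ M) : IsTangentVector M x v := by
  obtain ⟨U, V, φ, ψ, hU, hV, hxU, hφ, hψ, hφUV, hψVU, hψφ, hφψ, himg⟩ := hM x hx
  have hφx : HasFDerivAt φ (fderiv ℝ φ x) x :=
    ((hφ.contDiffAt (hU.mem_nhds hxU)).differentiableAt (by simp)).hasFDerivAt
  have hψx : HasFDerivAt ψ (fderiv ℝ ψ (φ x)) (φ x) :=
    ((hψ.contDiffAt (hV.mem_nhds (hφUV hxU))).differentiableAt (by simp)).hasFDerivAt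
  set w := fderiv ℝ φ x v with hw
  have hline (y u : EuclideanSpace ℝ (Fin d)) : HasDerivAt (fun t : ℝ => y + t • u) u 0 := by
    simpa using ((hasDerivAt_id (0 : ℝ)).smul_const u).const_add y
  have hplane {y : EuclideanSpace ℝ (Fin d)} (hy : y ∈ M) (hyU : y ∈ U) : φ y ∈ hyperplane d :=
    (himg ▸ mem_image_of_mem φ ⟨hy, hyU⟩ : φ y ∈ hyperplane d ∩ V).1
  have hφv : HasDerivAt (fun t : ℝ => φ (x + t • v)) w 0 :=
    HasFDerivAt.comp_hasDerivAt (0 : ℝ) (by simpa using hφx) (hline x v)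
  have hevU : ∀ᶠ h : ℝ in nhdsWithin 0 (Ioi 0), x + h • v ∈ U :=
    ((hline x v).continuousAt.eventually_mem (hU.mem_nhds (by simpa using hxU))).filter_mono
      nhdsWithin_le_nhds
  have hwplane : w ∈ hyperplane d := by
    intro i hi
    have hlim := ((EuclideanSpace.proj (𝕜 := ℝ) i).continuous.tendsto w).comp
      hφv.tendsto_slope_zero_right
    refine isClosed_singleton.mem_of_frequently_of_tendsto (b := nhdsWithin (0 : ℝ) (Ioi 0))
      (s := {(0 : ℝ)}) ?_ hlim
    refine (hv.and_eventually hevU).mono fun h hh => ?_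
    have h₁ := hplane hh.1 hh.2 i hi
    have h₂ := hplane hx hxU i hi
    simp [h₁, h₂]
  have hevV : ∀ᶠ t : ℝ in nhds 0, φ x + t • w ∈ V :=
    (hline (φ x) w).continuousAt.eventually_mem (hV.mem_nhds (by simpa using hφUV hxU))
  obtain ⟨ε, hε, hball⟩ := Metric.eventually_nhds_iff.1 hevV
  have hIoo : ∀ t ∈ Ioo (-ε) ε, φ x + t • w ∈ V := fun t ht =>
    hball (by simpa [Real.dist_eq, abs_lt] using ht)
  refine ⟨ε, hε, fun t => ψ (φ x + t • w), fun t ht => ?_, ?_, by simpa using hψφ x hxU, ?_⟩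
  · have hmem : φ x + t • w ∈ hyperplane d ∩ V := by
      refine ⟨fun i hi => ?_, hIoo t ht⟩
      simp [hplane hx hxU i hi, hwplane i hi]
    rw [← himg] at hmem
    obtain ⟨m, ⟨hm, hmU⟩, hmeq⟩ := hmem
    simpa only [← hmeq, hψφ m hmU] using hm
  · exact ContDiffOn.comp (t := V) hψ (by fun_prop) hIoo
  · have hψw : HasDerivAt (fun t : ℝ => ψ (φ x + t • w)) (fderiv ℝ ψ (φ x) w) 0 :=
      HasFDerivAt.comp_hasDerivAt (0 : ℝ) (by simpa using hψx) (hline (φ x) w)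
    have hid : HasFDerivAt id ((fderiv ℝ ψ (φ x)).comp (fderiv ℝ φ x)) x :=
      (hψx.comp x hφx).congr_of_eventuallyEq <|
        (hU.eventually_mem hxU).mono fun y hy => (hψφ y hy).symm
    have hfix := congrArg (fun A => A v) (hid.unique (hasFDerivAt_id x))
    have hv' : fderiv ℝ ψ (φ x) w = v := by simpa using hfix
    rwa [hv'] at hψw

/-- The intrinsic distance of the endpoints of a segment contained in `A` is at most
their distance. -/
lemma intrinsicDist_le_edist {d : ℕ} {A : Set (EuclideanSpace ℝ (Fin d))}
    {x y : EuclideanSpace ℝ (Fin d)} (h : segment ℝ x y ⊆ A) :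
    intrinsicDist A x y ≤ edist x y := by
  have hlip : LipschitzWith (nndist x y) (AffineMap.lineMap x y : ℝ → _) :=
    lipschitzWith_lineMap x y
  refine (iInf₂_le (AffineMap.lineMap x y : ℝ → _) hlip.continuous.continuousOn).trans ?_
  refine (iInf₂_le (fun t ht => h ?_) (by simp)).trans ((iInf_le _ (by simp)).trans ?_)
  · rw [segment_eq_image_lineMap]
    exact mem_image_of_mem _ ht
  · have hvar : eVariationOn (id : ℝ → ℝ) (Icc 0 1) ≤ 1 := by
      have hle := (monotoneOn_id (s := Icc (0 : ℝ) 1)).eVariationOn_eq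
        (left_mem_Icc.2 zero_le_one) (right_mem_Icc.2 zero_le_one)
      rw [inter_self, id, id, sub_zero, ENNReal.ofReal_one] at hle
      exact hle.le
    calc eVariationOn (AffineMap.lineMap x y : ℝ → _) (Icc 0 1)
        ≤ nndist x y * eVariationOn (id : ℝ → ℝ) (Icc 0 1) :=
          (hlip.lipschitzOnWith (s := univ)).comp_eVariationOn_le (mapsTo_univ id _)
      _ ≤ nndist x y * 1 := by gcongr
      _ = edist x y := by rw [mul_one, edist_nndist]

/-- existence of one-sided limits at the hypersurface. Let `Θ ⊆ ℝ^d`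
be a nonempty orientable `C^1`-hypersurface of positive reach with normal vector `n`
along `Θ`, and let `μ : ℝ^d → ℝ^d` be intrinsic Lipschitz continuous on `ℝ^d \ Θ`.
Then for every `x ∈ Θ` and every sign `s ∈ {+1, -1}` the limit
`lim_{h ↓ 0} μ(x + s·h·n(x))` exists in `ℝ^d`. -/
theorem one_sided_limits_exist
    (d : ℕ) (hd : 0 < d)
    (Θ : Set (EuclideanSpace ℝ (Fin d))) (hΘne : Θ.Nonempty)
    (hΘ : IsCkHypersurface 1 Θ) (hΘreach : 0 < reach Θ)
    (n : EuclideanSpace ℝ (Fin d) → EuclideanSpace ℝ (Fin d))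
    (hn : IsNormalVector Θ n)
    (μ : EuclideanSpace ℝ (Fin d) → EuclideanSpace ℝ (Fin d))
    (hμ : ∃ L : ℝ≥0, IntrinsicLipschitzWith L Θᶜ μ) :
    ∀ x ∈ Θ, ∀ s : ℝ, (s = 1 ∨ s = -1) →
      ∃ z : EuclideanSpace ℝ (Fin d),
        Filter.Tendsto (fun h : ℝ => μ (x + (s * h) • n x))
          (nhdsWithin 0 (Set.Ioi 0)) (nhds z) := by
  obtain ⟨L, hL⟩ := hμ
  intro x hx s hs
  have hs0 : s ≠ 0 := by rcases hs with rfl | rfl <;> norm_num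
  have hoff : ∀ᶠ h : ℝ in nhdsWithin 0 (Ioi 0), x + h • (s • n x) ∈ Θᶜ := by
    by_contra hfreq
    have hinner := hn.2.2 x hx _ (isTangentVector_of_frequently_mem hΘ hx hfreq)
    simp [inner_smul_right, hn.2.1 x hx, hs0] at hinner
  obtain ⟨ε, hε, hsub⟩ := mem_nhdsGT_iff_exists_Ioo_subset.1 hoff
  let ray : ℝ →ᵃ[ℝ] EuclideanSpace ℝ (Fin d) := AffineMap.lineMap x (x + s • n x)
  have hray (h : ℝ) : ray h = x + h • (s • n x) := by simp [ray, AffineMap.lineMap_apply, add_comm]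
  have hraylip : LipschitzWith (nndist x (x + s • n x)) ray := lipschitzWith_lineMap _ _
  have hlip : LipschitzOnWith (L * nndist x (x + s • n x)) (μ ∘ ray) (Ioo 0 ε) := by
    intro a ha b hb
    have hseg : segment ℝ (ray a) (ray b) ⊆ Θᶜ := by
      rw [← image_segment]
      rintro _ ⟨h, hh, rfl⟩
      rw [hray]
      exact hsub ((convex_Ioo 0 ε).segment_subset ha hb hh)
    calc edist (μ (ray a)) (μ (ray b))
        ≤ L * intrinsicDist Θᶜ (ray a) (ray b) :=
          hL _ (hseg (left_mem_segment ℝ _ _)) _ (hseg (right_mem_segment ℝ _ _))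
      _ ≤ L * edist (ray a) (ray b) := by gcongr; exact intrinsicDist_le_edist hseg
      _ ≤ L * (nndist x (x + s • n x) * edist a b) := by gcongr; exact hraylip a b
      _ = _ := by rw [ENNReal.coe_mul, mul_assoc]
  obtain ⟨g, hg, hgeq⟩ := hlip.extend_finite_dimension
  refine ⟨g 0, ((hg.continuous.tendsto 0).mono_left nhdsWithin_le_nhds).congr' ?_⟩
  filter_upwards [Ioo_mem_nhdsGT hε] with h hh
  rw [← hgeq hh, Function.comp_apply, hray, smul_smul, mul_comm]
end

section
/- Let d ∈ ℕ, let M ⊂ ℝ^d be a nonempty C^1-hypersurface of positive reach, let 𝔫 : M → ℝ^d be a normal vector along M, and let ε ∈ (0, reach(M)). Define Q_{ε,+} = {x + λ𝔫(x) : x ∈ M, λ ∈ (0, ε)} and Q_{ε,−} = {x + λ𝔫(x) : x ∈ M, λ ∈ (−ε, 0)}. Then Q_{ε,+} and Q_{ε,−} are open and disjoint, and M^ε \ M = Q_{ε,+} ∪ Q_{ε,−}. -/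
open Set Metric Filter MeasureTheory
open scoped ENNReal NNReal RealInnerProductSpace ContDiff

open scoped Topology Asymptotics

theorem isClosed_of_subset_unp {d : ℕ} {M : Set (EuclideanSpace ℝ (Fin d))} {r : ℝ} (hr : 0 < r)
    (hunp : {x | infDist x M < r} ⊆ unp M) : IsClosed M := by
  refine isClosed_of_closure_subset fun x hx => ?_
  have h0 : infDist x M = 0 := infDist_zero_of_mem_closure hx
  obtain ⟨p, ⟨hp, hdist⟩, -⟩ := hunp (show infDist x M < r by rwa [h0])
  rw [h0, dist_eq_zero] at hdist
  exact hdist ▸ hp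

theorem IsNearestPt.eq_of_mem_unp {d : ℕ} {M : Set (EuclideanSpace ℝ (Fin d))}
    {y p q : EuclideanSpace ℝ (Fin d)} (hp : IsNearestPt M y p) (hq : IsNearestPt M y q)
    (hy : y ∈ unp M) : p = q :=
  hy.unique hp hq

theorem isNearestPt_self {d : ℕ} {M : Set (EuclideanSpace ℝ (Fin d))}
    {x : EuclideanSpace ℝ (Fin d)} (hx : x ∈ M) : IsNearestPt M x x :=
  ⟨hx, by rw [dist_self, infDist_zero_of_mem hx]⟩

/-- Nearest points depend continuously on the base point wherever they are unique. -/
theorem eventually_dist_nearestPt_lt {d : ℕ} {M : Set (EuclideanSpace ℝ (Fin d))}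
    (hM : IsClosed M) {y p : EuclideanSpace ℝ (Fin d)} (hy : y ∈ unp M) (hp : IsNearestPt M y p)
    {ν : ℝ} (hν : 0 < ν) : ∀ᶠ z in 𝓝 y, ∀ q, IsNearestPt M z q → dist q p < ν := by
  set C : Set (EuclideanSpace ℝ (Fin d)) := (M ∩ (ball p ν)ᶜ) ∩ closedBall y (infDist y M + 2)
  have hC : IsCompact C :=
    (isCompact_closedBall _ _).inter_left (hM.inter isOpen_ball.isClosed_compl)
  obtain ⟨m, hm, hmC⟩ : ∃ m, infDist y M < m ∧ ∀ q ∈ C, m ≤ dist y q := by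
    rcases C.eq_empty_or_nonempty with h | h
    · exact ⟨infDist y M + 1, by linarith, by simp [h]⟩
    · obtain ⟨q, hq, hmin⟩ := hC.exists_isMinOn h
        (f := fun q => dist y q) (by fun_prop)
      refine ⟨dist y q, lt_of_le_of_ne (infDist_le_dist_of_mem hq.1.1) fun heq => ?_, hmin⟩
      have hqp : q = p := IsNearestPt.eq_of_mem_unp ⟨hq.1.1, heq.symm⟩ hp hy
      exact hq.1.2 (by simpa [hqp] using hν)
  have hτ : 0 < min 1 ((m - infDist y M) / 2) := lt_min one_pos (by linarith)
  filter_upwards [ball_mem_nhds y hτ] with z hz q hq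
  have hz1 : dist z y < 1 := lt_of_lt_of_le hz (min_le_left _ _)
  have hz2 : dist z y < (m - infDist y M) / 2 := lt_of_lt_of_le hz (min_le_right _ _)
  have h1 : infDist z M ≤ infDist y M + dist z y := infDist_le_infDist_add_dist
  have h2 : dist y q ≤ dist z y + dist z q := by
    rw [dist_comm z y]; exact dist_triangle _ _ _
  rw [hq.2] at h2
  by_contra hcon
  have := hmC q ⟨⟨hq.1, by simpa using hcon⟩, by
    rw [mem_closedBall, dist_comm]; linarith⟩
  linarith

/-- The distance function has slope `1` at a point off `M` with a unique nearest point. -/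
theorem exists_infDist_slope {d : ℕ} {M : Set (EuclideanSpace ℝ (Fin d))}
    (hM : IsClosed M) (hne : M.Nonempty) {z : EuclideanSpace ℝ (Fin d)} (hz : z ∈ unp M)
    (hpos : 0 < infDist z M) {η : ℝ} (hη0 : 0 < η) (hη : η < 1) {τ : ℝ} (hτ : 0 < τ) :
    ∃ h : EuclideanSpace ℝ (Fin d), ‖h‖ < τ ∧ infDist z M + η * ‖h‖ < infDist (z + h) M := by
  obtain ⟨p, hp, -⟩ := id hz
  set δ := infDist z M with hδ
  have hp' : IsNearestPt M z p := hp
  have hzp : ‖z - p‖ = δ := by rw [← dist_eq_norm]; exact hp.2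
  set u := δ⁻¹ • (z - p) with hu
  have hu1 : ‖u‖ = 1 := by
    rw [hu, norm_smul, hzp, norm_inv, Real.norm_of_nonneg hpos.le, inv_mul_cancel₀ hpos.ne']
  have hup : ⟪u, z - p⟫ = δ := by
    rw [hu, real_inner_smul_left, real_inner_self_eq_norm_sq, hzp]; field_simp
  have hν : 0 < (1 - η) * δ := mul_pos (by linarith) hpos
  obtain ⟨κ, hκ, hball⟩ := Metric.eventually_nhds_iff.1
    (eventually_dist_nearestPt_lt hM hz hp' hν)
  set t := min κ τ / 2 with ht
  have hmin : 0 < min κ τ := lt_min hκ hτ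
  have ht0 : 0 < t := by positivity
  have htκ : t < κ := by have := min_le_left κ τ; linarith
  have htτ : t < τ := by have := min_le_right κ τ; linarith
  have hnorm : ‖t • u‖ = t := by rw [norm_smul, hu1, mul_one, Real.norm_of_nonneg ht0.le]
  refine ⟨t • u, by rwa [hnorm], ?_⟩
  obtain ⟨q, hq, hdist⟩ := hM.exists_infDist_eq_dist hne (z + t • u)
  have hqp : dist q p < (1 - η) * δ :=
    hball (by simpa [hnorm] using htκ) q ⟨hq, hdist.symm⟩
  have hinner : η * δ ≤ ⟪u, z - q⟫ := by
    have h1 : ⟪u, z - q⟫ = δ - ⟪u, q - p⟫ := by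
      rw [← hup, ← inner_sub_right]; congr 1; abel
    have h2 : ⟪u, q - p⟫ ≤ ‖u‖ * ‖q - p‖ := real_inner_le_norm _ _
    rw [hu1, one_mul, ← dist_eq_norm] at h2
    linarith
  have hzq : δ ≤ ‖z - q‖ := by rw [← dist_eq_norm]; exact infDist_le_dist_of_mem hq
  rw [hnorm, hdist, dist_eq_norm]
  refine lt_of_pow_lt_pow_left₀ 2 (norm_nonneg _) ?_
  have hexp : ‖z + t • u - q‖ ^ 2 = ‖z - q‖ ^ 2 + 2 * (t * ⟪u, z - q⟫) + t ^ 2 := by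
    rw [show z + t • u - q = (z - q) + t • u by abel, norm_add_sq_real, hnorm,
      real_inner_smul_right, real_inner_comm]
  rw [hexp]
  have h3 : δ ^ 2 ≤ ‖z - q‖ ^ 2 := pow_le_pow_left₀ hpos.le hzq 2
  have h4 : t * (η * δ) ≤ t * ⟪u, z - q⟫ := mul_le_mul_of_nonneg_left hinner ht0.le
  have h5 : η ^ 2 * t ^ 2 < t ^ 2 := by
    have : η ^ 2 < 1 := by nlinarith
    nlinarith [pow_pos ht0 2]
  nlinarith

/-- The distance to `M` grows at unit speed along the normal ray, up to the reach. -/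
theorem exists_infDist_eq_of_lt {d : ℕ} {M : Set (EuclideanSpace ℝ (Fin d))}
    (hM : IsClosed M) (hne : M.Nonempty) {r : ℝ} (hunp : {x | infDist x M < r} ⊆ unp M)
    {y : EuclideanSpace ℝ (Fin d)} (hpos : 0 < infDist y M) {s : ℝ} (hs : infDist y M < s)
    (hsr : s < r) : ∃ z, dist z y = s - infDist y M ∧ infDist z M = s := by
  set δ := infDist y M with hδ
  have hlip : ∀ z, infDist z M ≤ δ + dist z y := fun z => infDist_le_infDist_add_dist
  have hη : ∀ η : ℝ, 0 < η → η < 1 →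
      ∃ z ∈ sphere y (s - δ), δ + η * (s - δ) ≤ infDist z M := by
    intro η hη0 hη1
    obtain ⟨z, hz, hmax⟩ := (isCompact_closedBall y (s - δ)).exists_isMaxOn
      (nonempty_closedBall.2 (by linarith)) (f := fun z => infDist z M - η * dist z y)
      (by have := continuous_infDist_pt M; fun_prop)
    have hmax' : ∀ w ∈ closedBall y (s - δ),
      infDist w M - η * dist w y ≤ infDist z M - η * dist z y := hmax
    have h0 := hmax' y (mem_closedBall_self (by linarith))
    rw [dist_self, mul_zero, sub_zero, ← hδ] at h0
    rcases (mem_closedBall.1 hz).lt_or_eq with hlt | heq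
    · exfalso
      have hzpos : 0 < infDist z M := by
        have : 0 ≤ η * dist z y := by positivity
        linarith
      obtain ⟨h, hh, hgrow⟩ := exists_infDist_slope hM hne
        (hunp (show infDist z M < r by linarith [hlip z])) hzpos hη0 hη1 (sub_pos.2 hlt)
      have htri : dist (z + h) y ≤ ‖h‖ + dist z y := by
        refine (dist_triangle _ z _).trans (by simp)
      have := hmax' (z + h) (mem_closedBall.2 (by linarith))
      nlinarith
    · exact ⟨z, heq, by rw [← heq]; linarith⟩
  obtain ⟨z₀, hz₀, -⟩ := hη (1 / 2) (by norm_num) (by norm_num)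
  obtain ⟨z, hz, hmax⟩ := (isCompact_sphere y (s - δ)).exists_isMaxOn ⟨z₀, hz₀⟩
    (f := fun z => infDist z M) (continuous_infDist_pt M).continuousOn
  have hzy : dist z y = s - δ := hz
  refine ⟨z, hzy, le_antisymm (by linarith [hlip z]) ?_⟩
  have hlim : Tendsto (fun η : ℝ => δ + η * (s - δ)) (𝓝[<] 1) (𝓝 (δ + 1 * (s - δ))) :=
    Continuous.tendsto' (by fun_prop) _ _ rfl |>.mono_left nhdsWithin_le_nhds
  have hle : δ + 1 * (s - δ) ≤ infDist z M := by
    refine le_of_tendsto hlim ?_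
    filter_upwards [Ioo_mem_nhdsLT (zero_lt_one' ℝ)] with η hη'
    obtain ⟨w, hw, hle⟩ := hη η hη'.1 hη'.2
    exact hle.trans (hmax hw)
  linarith

theorem infDist_add_smul_of_isNearestPt {d : ℕ} {M : Set (EuclideanSpace ℝ (Fin d))}
    (hM : IsClosed M) {r : ℝ} (hunp : {x | infDist x M < r} ⊆ unp M)
    {p u : EuclideanSpace ℝ (Fin d)} (hu : ‖u‖ = 1) {t : ℝ} (ht : 0 < t)
    (hp : IsNearestPt M (p + t • u) p) {s : ℝ} (hs : 0 < s) (hsr : s < r) :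
    infDist (p + s • u) M = s := by
  have hnorm : ∀ a : ℝ, 0 < a → ‖a • u‖ = a := fun a ha => by
    rw [norm_smul, hu, mul_one, Real.norm_of_nonneg ha.le]
  have hδ : infDist (p + t • u) M = t := by
    rw [← hp.2, dist_eq_norm, add_sub_cancel_left, hnorm t ht]
  have hle : infDist (p + s • u) M ≤ s := by
    refine (infDist_le_dist_of_mem hp.1).trans ?_
    rw [dist_eq_norm, add_sub_cancel_left, hnorm s hs]
  rcases le_or_gt s t with hst | hst
  · refine le_antisymm hle ?_
    have h := infDist_le_infDist_add_dist (s := M) (x := p + t • u) (y := p + s • u)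
    rw [hδ, dist_eq_norm, add_sub_add_left_eq_sub, ← sub_smul, norm_smul, hu, mul_one,
      Real.norm_of_nonneg (sub_nonneg.2 hst)] at h
    linarith
  · obtain ⟨z, hz, hzs⟩ := exists_infDist_eq_of_lt hM ⟨p, hp.1⟩ hunp (y := p + t • u) (by rwa [hδ])
      (by rwa [hδ]) hsr
    rw [hδ] at hz
    set w := z - (p + t • u) with hw
    have hwn : ‖w‖ = s - t := by rw [hw, ← dist_eq_norm, hz]
    have hzp : s ≤ ‖w + t • u‖ := by
      have hzw : w + t • u = z - p := by rw [hw]; abel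
      rw [hzw, ← dist_eq_norm, ← hzs]
      exact infDist_le_dist_of_mem hp.1
    have hsq : s ^ 2 ≤ ‖w + t • u‖ ^ 2 := pow_le_pow_left₀ hs.le hzp 2
    rw [norm_add_sq_real, hwn, hnorm t ht, real_inner_smul_right] at hsq
    have hin : s - t ≤ ⟪w, u⟫ := by
      have : t * (s - t) ≤ t * ⟪w, u⟫ := by nlinarith
      exact le_of_mul_le_mul_left this ht
    have hweq : w = (s - t) • u := by
      rw [← sub_eq_zero, ← norm_eq_zero, ← sq_eq_zero_iff]
      refine le_antisymm ?_ (sq_nonneg _)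
      rw [norm_sub_sq_real, hwn, hnorm _ (by linarith), real_inner_smul_right]
      nlinarith
    have hzeq : z = p + s • u := by
      have : z = w + (p + t • u) := by rw [hw]; abel
      rw [this, hweq, sub_smul]; abel
    rw [← hzeq, hzs]

/-- At each point, a `C^1`-hypersurface is flat to first order along the kernel of a linear
functional, and this kernel consists of tangent vectors. -/
theorem IsCkHypersurface.exists_tangent_functional {d : ℕ} (hd : 0 < d)
    {M : Set (EuclideanSpace ℝ (Fin d))} (hM : IsCkHypersurface 1 M)
    {x : EuclideanSpace ℝ (Fin d)} (hx : x ∈ M) :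
    ∃ (L : EuclideanSpace ℝ (Fin d) →L[ℝ] ℝ) (e : EuclideanSpace ℝ (Fin d)),
      (∀ v, IsTangentVector M x (v - L v • e)) ∧
      (fun q => L (q - x)) =o[𝓝[M] x] fun q => q - x := by
  obtain ⟨U, V, φ, ψ, hU, hV, hxU, hφ, hψ, hφm, hψm, hψφ, hφψ, himg⟩ := hM x hx
  have hone : ((1 : ℕ∞) : WithTop ℕ∞) = 1 := rfl
  rw [hone] at hφ hψ
  have hxV : φ x ∈ V := hφm hxU
  have hA := (hψ.contDiffAt (hV.mem_nhds hxV)).differentiableAt one_ne_zero |>.hasFDerivAt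
  have hB := (hφ.contDiffAt (hU.mem_nhds hxU)).differentiableAt one_ne_zero |>.hasFDerivAt
  set A := fderiv ℝ ψ (φ x)
  set B := fderiv ℝ φ x
  have hAB : ∀ v, A (B v) = v := by
    have h1 : HasFDerivAt (ψ ∘ φ) (A.comp B) x := hA.comp x hB
    have h2 : HasFDerivAt (ψ ∘ φ) (ContinuousLinearMap.id ℝ _) x :=
      (hasFDerivAt_id x).congr_of_eventuallyEq
        (by filter_upwards [hU.mem_nhds hxU] with y hy using hψφ y hy)
    intro v
    simpa using congrArg (fun T => T v) (h1.unique h2)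
  set i : Fin d := ⟨d - 1, by omega⟩
  have hmem : ∀ y, y ∈ hyperplane d ↔ y i = 0 := fun y =>
    ⟨fun h => h i rfl, fun h j hj => by rwa [show j = i from Fin.ext hj]⟩
  have hφM : ∀ q ∈ M ∩ U, φ q i = 0 := fun q hq =>
    (hmem _).1 (himg.subset (mem_image_of_mem φ hq)).1
  have hψM : ∀ y ∈ V, y i = 0 → ψ y ∈ M := by
    intro y hy hyi
    obtain ⟨q, hq, rfl⟩ := himg.superset ⟨(hmem y).2 hyi, hy⟩
    rw [hψφ q hq.2]; exact hq.1
  set L : EuclideanSpace ℝ (Fin d) →L[ℝ] ℝ := (EuclideanSpace.proj i).comp B with hL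
  have hLv : ∀ v, L v = B v i := fun v => rfl
  refine ⟨L, A (EuclideanSpace.single i 1), fun v => ?_, ?_⟩
  · set h := B v - L v • EuclideanSpace.single i (1 : ℝ) with hh
    have hhi : h i = 0 := by simp [hh, hLv]
    have hAh : v - L v • A (EuclideanSpace.single i 1) = A h := by
      rw [hh, map_sub, map_smul, hAB]
    rw [hAh]
    have hline : Continuous fun t : ℝ => φ x + t • h := by fun_prop
    have hnhds : (fun t : ℝ => φ x + t • h) ⁻¹' V ∈ 𝓝 (0 : ℝ) :=
      hline.continuousAt.preimage_mem_nhds (hV.mem_nhds (by simpa using hxV))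
    obtain ⟨κ, hκ, hball⟩ := Metric.mem_nhds_iff.1 hnhds
    rw [Real.ball_eq_Ioo, zero_sub, zero_add] at hball
    refine ⟨κ, hκ, fun t => ψ (φ x + t • h), fun t ht => hψM _ (hball ht) ?_, ?_, ?_, ?_⟩
    · simp [hφM x ⟨hx, hxU⟩, hhi]
    · exact hψ.comp (by fun_prop : ContDiff ℝ 1 fun t : ℝ => φ x + t • h).contDiffOn
        fun t ht => hball ht
    · simpa using hψφ x hxU
    · have hl : HasDerivAt (fun t : ℝ => φ x + t • h) h 0 := by
        simpa using ((hasDerivAt_id (0 : ℝ)).smul_const h).const_add (φ x)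
      exact HasFDerivAt.comp_hasDerivAt (0 : ℝ) (by simpa using hA) hl
  · have hd1 : HasFDerivAt (fun q => φ q i) L x :=
      (EuclideanSpace.proj i : EuclideanSpace ℝ (Fin d) →L[ℝ] ℝ).hasFDerivAt.comp x hB
    have ho := (hd1.isLittleO.mono (nhdsWithin_le_nhds (s := M))).neg_left
    refine ho.congr' ?_ EventuallyEq.rfl
    filter_upwards [self_mem_nhdsWithin, nhdsWithin_le_nhds (hU.mem_nhds hxU)] with q hq hqU
    simp [hφM q ⟨hq, hqU⟩, hφM x ⟨hx, hxU⟩]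

theorem IsNormalVector.isLittleO_inner {d : ℕ} (hd : 0 < d)
    {M : Set (EuclideanSpace ℝ (Fin d))} (hM : IsCkHypersurface 1 M)
    {n : EuclideanSpace ℝ (Fin d) → EuclideanSpace ℝ (Fin d)} (hn : IsNormalVector M n)
    {x : EuclideanSpace ℝ (Fin d)} (hx : x ∈ M) :
    (fun q => ⟪n x, q - x⟫) =o[𝓝[M] x] fun q => q - x := by
  obtain ⟨L, e, htan, ho⟩ := hM.exists_tangent_functional hd hx
  refine (ho.const_mul_left ⟪n x, e⟫).congr_left fun q => ?_
  have := hn.2.2 x hx _ (htan (q - x))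
  rw [inner_sub_right, real_inner_smul_right] at this
  linarith

/-- Vectors orthogonal to all tangent vectors are multiples of the unit normal. -/
theorem IsNormalVector.eq_smul_of_inner_eq_zero {d : ℕ} (hd : 0 < d)
    {M : Set (EuclideanSpace ℝ (Fin d))} (hM : IsCkHypersurface 1 M)
    {n : EuclideanSpace ℝ (Fin d) → EuclideanSpace ℝ (Fin d)} (hn : IsNormalVector M n)
    {x w : EuclideanSpace ℝ (Fin d)} (hx : x ∈ M)
    (hw : ∀ v, IsTangentVector M x v → ⟪w, v⟫ = 0) : w = ⟪w, n x⟫ • n x := by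
  obtain ⟨L, e, htan, -⟩ := hM.exists_tangent_functional hd hx
  have key : ∀ w', (∀ v, IsTangentVector M x v → ⟪w', v⟫ = 0) → ∀ v, ⟪w', v⟫ = L v * ⟪w', e⟫ := by
    intro w' hw' v
    have := hw' _ (htan v)
    rw [inner_sub_right, real_inner_smul_right] at this
    linarith
  have hnn : ⟪n x, n x⟫ = 1 := by rw [real_inner_self_eq_norm_sq, hn.2.1 x hx]; norm_num
  set w' := w - ⟪w, n x⟫ • n x with hw'
  have hw't : ∀ v, IsTangentVector M x v → ⟪w', v⟫ = 0 := fun v hv => by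
    rw [hw', inner_sub_left, real_inner_smul_left, hw v hv, hn.2.2 x hx v hv]; ring
  have h0 : ⟪w', n x⟫ = 0 := by
    rw [hw', inner_sub_left, real_inner_smul_left, hnn]; ring
  have hLn : L (n x) ≠ 0 := fun h => by
    have := key (n x) (hn.2.2 x hx) (n x)
    rw [hnn, h] at this
    norm_num at this
  have he : ⟪w', e⟫ = 0 := by
    have := key w' hw't (n x)
    rw [h0] at this
    exact (mul_eq_zero.1 this.symm).resolve_left hLn
  have hz : w' = 0 := by
    rw [← inner_self_eq_zero (𝕜 := ℝ), key w' hw't w', he, mul_zero]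
  exact sub_eq_zero.1 hz

theorem IsNearestPt.inner_tangent_eq_zero {d : ℕ} {M : Set (EuclideanSpace ℝ (Fin d))}
    {y p v : EuclideanSpace ℝ (Fin d)} (hp : IsNearestPt M y p) (hv : IsTangentVector M p v) :
    ⟪y - p, v⟫ = 0 := by
  obtain ⟨κ, hκ, γ, hγM, -, hγ0, hγ⟩ := hv
  have hmin : IsLocalMin (fun t => ‖y - γ t‖ ^ 2) 0 := by
    filter_upwards [Ioo_mem_nhds (neg_lt_zero.2 hκ) hκ] with t ht
    rw [hγ0, ← dist_eq_norm, ← dist_eq_norm, hp.2]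
    exact pow_le_pow_left₀ infDist_nonneg (infDist_le_dist_of_mem (hγM t ht)) 2
  have h := hmin.hasDerivAt_eq_zero (hγ.const_sub y).norm_sq
  rw [hγ0, inner_neg_right] at h
  linarith

theorem IsNormalVector.neg {d : ℕ} {M : Set (EuclideanSpace ℝ (Fin d))}
    {n : EuclideanSpace ℝ (Fin d) → EuclideanSpace ℝ (Fin d)} (hn : IsNormalVector M n) :
    IsNormalVector M fun x => -n x :=
  ⟨hn.1.neg, fun x hx => by rw [norm_neg, hn.2.1 x hx], fun x hx v hv => by
    rw [inner_neg_left, hn.2.2 x hx v hv, neg_zero]⟩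

theorem IsNearestPt.sub_eq_smul {d : ℕ} (hd : 0 < d)
    {M : Set (EuclideanSpace ℝ (Fin d))} (hM : IsCkHypersurface 1 M)
    {n : EuclideanSpace ℝ (Fin d) → EuclideanSpace ℝ (Fin d)} (hn : IsNormalVector M n)
    {y p : EuclideanSpace ℝ (Fin d)} (hp : IsNearestPt M y p) :
    y - p = ⟪y - p, n p⟫ • n p :=
  hn.eq_smul_of_inner_eq_zero hd hM hp.1 fun _ hv => hp.inner_tangent_eq_zero hv

theorem IsNormalVector.infDist_add_smul_of_pos {d : ℕ} (hd : 0 < d)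
    {M : Set (EuclideanSpace ℝ (Fin d))} (hM : IsCkHypersurface 1 M)
    {n : EuclideanSpace ℝ (Fin d) → EuclideanSpace ℝ (Fin d)} (hn : IsNormalVector M n)
    {r : ℝ} (hunp : {x | infDist x M < r} ⊆ unp M)
    {x : EuclideanSpace ℝ (Fin d)} (hx : x ∈ M) {s : ℝ} (hs : 0 < s) (hsr : s < r) :
    infDist (x + s • n x) M = s := by
  have hclosed : IsClosed M := isClosed_of_subset_unp (hs.trans hsr) hunp
  have hxunp : x ∈ unp M := hunp (show infDist x M < r by
    rw [infDist_zero_of_mem hx]; exact hs.trans hsr)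
  have hnx : ⟪n x, n x⟫ = 1 := by rw [real_inner_self_eq_norm_sq, hn.2.1 x hx]; norm_num
  have hray : Tendsto (fun t : ℝ => x + t • n x) (𝓝[>] 0) (𝓝 x) :=
    (Continuous.tendsto' (by fun_prop) _ _ (by simp)).mono_left nhdsWithin_le_nhds
  choose p hpM hpdist using fun t : ℝ => hclosed.exists_infDist_eq_dist ⟨x, hx⟩ (x + t • n x)
  have hp : ∀ t, IsNearestPt M (x + t • n x) (p t) := fun t => ⟨hpM t, (hpdist t).symm⟩
  have hlim : Tendsto p (𝓝[>] 0) (𝓝[M] x) := by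
    refine tendsto_nhdsWithin_iff.2 ⟨Metric.tendsto_nhds.2 fun ν hν => ?_, .of_forall hpM⟩
    filter_upwards [hray.eventually
      (eventually_dist_nearestPt_lt hclosed hxunp (isNearestPt_self hx) hν)] with t ht
    exact ht _ (hp t)
  have hnlim : Tendsto (fun t => n (p t)) (𝓝[>] 0) (𝓝 (n x)) := (hn.1 x hx).tendsto.comp hlim
  have hinner : ∀ᶠ t in 𝓝[>] (0 : ℝ), 0 < ⟪n x, n (p t)⟫ := by
    have : Tendsto (fun t => ⟪n x, n (p t)⟫) (𝓝[>] 0) (𝓝 ⟪n x, n x⟫) :=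
      tendsto_const_nhds.inner hnlim
    rw [hnx] at this
    exact this.eventually (lt_mem_nhds one_pos)
  have hsmall : ∀ᶠ t in 𝓝[>] (0 : ℝ), ‖⟪n x, p t - x⟫‖ ≤ 1 / 4 * ‖p t - x‖ :=
    hlim.eventually ((hn.isLittleO_inner hd hM hx).bound (by norm_num))
  have hconst : ∀ᶠ t in 𝓝[>] (0 : ℝ), infDist (p t + s • n (p t)) M = s := by
    filter_upwards [hinner, hsmall, self_mem_nhdsWithin] with t hin hsm (ht : 0 < t)
    have heq := (hp t).sub_eq_smul hd hM hn
    set l := ⟪x + t • n x - p t, n (p t)⟫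
    have hnp : ‖n (p t)‖ = 1 := hn.2.1 _ (hpM t)
    have htn : ‖t • n x‖ = t := by
      rw [norm_smul, hn.2.1 x hx, mul_one, Real.norm_of_nonneg ht.le]
    have hl : |l| ≤ t := by
      have h1 := infDist_le_dist_of_mem (x := x + t • n x) hx
      rw [hpdist, dist_eq_norm, dist_eq_norm, heq, norm_smul, hnp, mul_one,
        add_sub_cancel_left, htn, Real.norm_eq_abs] at h1
      exact h1
    have hl0 : 0 < l := by
      by_contra! hneg
      have hpx : p t - x = t • n x - l • n (p t) := by rw [← heq]; abel
      have h1 : ‖p t - x‖ ≤ 2 * t := by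
        rw [hpx]
        refine (norm_sub_le _ _).trans ?_
        rw [htn, norm_smul, hnp, mul_one, Real.norm_eq_abs]
        linarith
      have h2 : t ≤ ⟪n x, p t - x⟫ := by
        rw [hpx, inner_sub_right, real_inner_smul_right, real_inner_smul_right, hnx]
        nlinarith
      have h3 := (le_abs_self _).trans hsm
      linarith
    have hy : p t + l • n (p t) = x + t • n x := by rw [← heq]; abel
    exact infDist_add_smul_of_isNearestPt hclosed hunp hnp hl0 (hy ▸ hp t) hs hsr
  have hfin : Tendsto (fun t => infDist (p t + s • n (p t)) M) (𝓝[>] 0)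
      (𝓝 (infDist (x + s • n x) M)) :=
    ((continuous_infDist_pt M).tendsto _).comp
      ((hlim.mono_right nhdsWithin_le_nhds).add (hnlim.const_smul s))
  exact tendsto_nhds_unique (hfin.congr' hconst) tendsto_const_nhds

theorem IsNormalVector.infDist_add_smul {d : ℕ} (hd : 0 < d)
    {M : Set (EuclideanSpace ℝ (Fin d))} (hM : IsCkHypersurface 1 M)
    {n : EuclideanSpace ℝ (Fin d) → EuclideanSpace ℝ (Fin d)} (hn : IsNormalVector M n)
    {r : ℝ} (hunp : {x | infDist x M < r} ⊆ unp M)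
    {x : EuclideanSpace ℝ (Fin d)} (hx : x ∈ M) {s : ℝ} (hsr : |s| < r) :
    infDist (x + s • n x) M = |s| := by
  rcases lt_trichotomy s 0 with h | rfl | h
  · rw [abs_of_neg h] at hsr ⊢
    simpa using hn.neg.infDist_add_smul_of_pos hd hM hunp hx (neg_pos.2 h) hsr
  · simpa using infDist_zero_of_mem hx
  · rw [abs_of_pos h] at hsr ⊢
    exact hn.infDist_add_smul_of_pos hd hM hunp hx h hsr

theorem IsNormalVector.isNearestPt_add_smul {d : ℕ} (hd : 0 < d)
    {M : Set (EuclideanSpace ℝ (Fin d))} (hM : IsCkHypersurface 1 M)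
    {n : EuclideanSpace ℝ (Fin d) → EuclideanSpace ℝ (Fin d)} (hn : IsNormalVector M n)
    {r : ℝ} (hunp : {x | infDist x M < r} ⊆ unp M)
    {x : EuclideanSpace ℝ (Fin d)} (hx : x ∈ M) {s : ℝ} (hsr : |s| < r) :
    IsNearestPt M (x + s • n x) x :=
  ⟨hx, by rw [hn.infDist_add_smul hd hM hunp hx hsr, dist_eq_norm, add_sub_cancel_left,
    norm_smul, hn.2.1 x hx, mul_one, Real.norm_eq_abs]⟩

/-- decomposition of the tubular neighbourhood into two sides. Let
`M ⊆ ℝ^d` be a nonempty `C^1`-hypersurface of positive reach with normal vector `n`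
along `M`, and let `ε ∈ (0, reach M)`. With
`Q₊ = {x + λ n(x) : x ∈ M, λ ∈ (0,ε)}` and `Q₋ = {x + λ n(x) : x ∈ M, λ ∈ (-ε,0)}`,
the sets `Q₊, Q₋` are open and disjoint, and `M^ε \ M = Q₊ ∪ Q₋`. -/
theorem tubular_neighbourhood_two_sides
    (d : ℕ) (hd : 0 < d)
    (M : Set (EuclideanSpace ℝ (Fin d))) (hMne : M.Nonempty)
    (hM : IsCkHypersurface 1 M) (hMreach : 0 < reach M)
    (n : EuclideanSpace ℝ (Fin d) → EuclideanSpace ℝ (Fin d))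
    (hn : IsNormalVector M n)
    (ε : ℝ) (hε : 0 < ε) (hεreach : ENNReal.ofReal ε < reach M)
    (Qp Qm : Set (EuclideanSpace ℝ (Fin d)))
    (hQp : Qp = {y | ∃ x ∈ M, ∃ l : ℝ, 0 < l ∧ l < ε ∧ y = x + l • n x})
    (hQm : Qm = {y | ∃ x ∈ M, ∃ l : ℝ, -ε < l ∧ l < 0 ∧ y = x + l • n x}) :
    IsOpen Qp ∧ IsOpen Qm ∧ Disjoint Qp Qm ∧
      {y | Metric.infDist y M < ε} \ M = Qp ∪ Qm := by
  obtain ⟨_, ⟨r, hr, rfl, hunp⟩, hεr⟩ := lt_sSup_iff.1 hεreach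
  replace hεr : ε < r := (ENNReal.ofReal_lt_ofReal_iff_of_nonneg hε.le).1 hεr
  have hclosed : IsClosed M := isClosed_of_subset_unp (hε.trans hεr) hunp
  choose p hpM hpdist using fun y => hclosed.exists_infDist_eq_dist hMne y
  have hp : ∀ y, IsNearestPt M y (p y) := fun y => ⟨hpM y, (hpdist y).symm⟩
  set T : Set (EuclideanSpace ℝ (Fin d)) := {y | infDist y M < ε} with hT
  have hTunp : T ⊆ unp M := fun y hy => hunp (lt_trans hy hεr)
  have hTopen : IsOpen T := isOpen_lt (continuous_infDist_pt M) continuous_const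
  have hpcont : ContinuousOn p T := by
    intro y hy
    refine ContinuousAt.continuousWithinAt (Metric.tendsto_nhds.2 fun ν hν => ?_)
    filter_upwards [eventually_dist_nearestPt_lt hclosed (hTunp hy) (hp y) hν] with z hz
    exact hz _ (hp z)
  set f : EuclideanSpace ℝ (Fin d) → ℝ := fun y => ⟪y - p y, n (p y)⟫ with hf
  have hfcont : ContinuousOn f T :=
    (continuousOn_id.sub hpcont).inner (𝕜 := ℝ) (hn.1.comp hpcont fun y _ => hpM y)
  have hdecomp : ∀ y, y = p y + f y • n (p y) := fun y => by
    rw [hf, ← (hp y).sub_eq_smul hd hM hn]; abel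
  have hfabs : ∀ y, |f y| = infDist y M := fun y => by
    rw [hpdist, dist_eq_norm, (hp y).sub_eq_smul hd hM hn, norm_smul, hn.2.1 _ (hpM y), mul_one,
      Real.norm_eq_abs]
  have hfval : ∀ x ∈ M, ∀ l : ℝ, |l| < ε → x + l • n x ∈ T ∧ f (x + l • n x) = l := by
    intro x hx l hl
    have hmem : x + l • n x ∈ T := by
      rwa [hT, mem_ofPred_eq, hn.infDist_add_smul hd hM hunp hx (hl.trans hεr)]
    have hpx : p (x + l • n x) = x := (hp _).eq_of_mem_unp
      (hn.isNearestPt_add_smul hd hM hunp hx (hl.trans hεr)) (hTunp hmem)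
    refine ⟨hmem, ?_⟩
    simp only [hf, hpx, add_sub_cancel_left, real_inner_smul_left, real_inner_self_eq_norm_sq,
      hn.2.1 x hx]
    ring
  have hQp' : Qp = T ∩ f ⁻¹' Ioi 0 := by
    rw [hQp]
    ext y
    constructor
    · rintro ⟨x, hx, l, hl, hlε, rfl⟩
      obtain ⟨h1, h2⟩ := hfval x hx l (by rwa [abs_of_pos hl])
      exact ⟨h1, by simpa [h2] using hl⟩
    · rintro ⟨hy, hpos : 0 < f y⟩
      refine ⟨p y, hpM y, f y, hpos, ?_, hdecomp y⟩
      rw [← abs_of_pos hpos, hfabs]; exact hy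
  have hQm' : Qm = T ∩ f ⁻¹' Iio 0 := by
    rw [hQm]
    ext y
    constructor
    · rintro ⟨x, hx, l, hlε, hl, rfl⟩
      obtain ⟨h1, h2⟩ := hfval x hx l (by rw [abs_of_neg hl]; linarith)
      exact ⟨h1, by simpa [h2] using hl⟩
    · rintro ⟨hy, hneg : f y < 0⟩
      refine ⟨p y, hpM y, f y, ?_, hneg, hdecomp y⟩
      have h : |f y| < ε := by rw [hfabs]; exact hy
      exact (abs_lt.1 h).1
  have hM0 : ∀ y, y ∈ M ↔ f y = 0 := fun y => by
    rw [hclosed.mem_iff_infDist_zero hMne, ← hfabs, abs_eq_zero]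
  rw [hQp', hQm']
  refine ⟨hfcont.isOpen_inter_preimage hTopen isOpen_Ioi,
    hfcont.isOpen_inter_preimage hTopen isOpen_Iio, ?_, ?_⟩
  · rw [Set.disjoint_left]
    rintro y ⟨-, h1 : 0 < f y⟩ ⟨-, h2 : f y < 0⟩
    exact lt_asymm h1 h2
  · ext y
    rw [← inter_union_distrib_left, Set.mem_sdiff, mem_inter_iff, hM0, ← preimage_union, union_comm,
      Iio_union_Ioi]
    rfl
end
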